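/- arXiv:1308.2466 — 2 statements merged into one kernel-verified Lean document; each statement's English description precedes it below -/
import Mathlib

section
/- Let β, γ, a, b be real numbers with 0 < β < 1, β < γ, a > 0, b > 0. Let G : [0, ∞) → [0, ∞) be differentiable with G(0) > 0, G′(t) ≤ b · G(t)^γ − a · G(t)^β for all t ≥ 0, and b · G(0)^{γ−β} < a. Set c = a − b · G(0)^{γ−β} and T₁ = G(0)^{1−β} / ((1 − β) · c). Then G(t)^{1−β} ≤ G(0)^{1−β} − (1 − β) · c · t for all t ∈ [0, T₁], and G(t) = 0 for all t ≥ T₁. -/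
open Set

/-- A trajectory of `G′ ≤ b G^γ − a G^β` with small initial data never exceeds its initial
value. -/
lemma le_initial_of_two_power_deriv_le {β γ a b : ℝ} {G G' : ℝ → ℝ} (hG0 : 0 < G 0)
    (hGdiff : ∀ t : ℝ, 0 ≤ t → HasDerivWithinAt G (G' t) (Ici 0) t)
    (hGineq : ∀ t : ℝ, 0 ≤ t → G' t ≤ b * G t ^ γ - a * G t ^ β)
    (hsmall : b * G 0 ^ (γ - β) < a) {t : ℝ} (ht : 0 ≤ t) : G t ≤ G 0 := by
  refine image_le_of_deriv_right_lt_deriv_boundary (f := G) (f' := G') (a := 0) (b := t)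
    (B := fun _ => G 0) (B' := fun _ => 0)
    (fun s hs => ((hGdiff s hs.1).mono Icc_subset_Ici_self).continuousWithinAt)
    (fun s hs => (hGdiff s hs.1).mono (Ici_subset_Ici.2 hs.1)) le_rfl
    (fun s => hasDerivAt_const s (G 0)) (fun s hs hGs => ?_) ⟨ht, le_rfl⟩
  have hineq := hGineq s hs.1
  have hpow : G 0 ^ γ = G 0 ^ (γ - β) * G 0 ^ β := by
    rw [← Real.rpow_add hG0, sub_add_cancel]
  rw [hGs, hpow] at hineq
  nlinarith [Real.rpow_pos_of_pos hG0 β]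

/-- Along a nonnegative solution of `G′ ≤ −c G^β` with `c ≥ 0` and `β < 1`, the quantity
`G^{1−β}` decays at least linearly for as long as `G` is positive. -/
lemma rpow_one_sub_le_of_deriv_le_neg_rpow {β c : ℝ} {G G' : ℝ → ℝ} (hβ1 : β < 1) (hc : 0 ≤ c)
    (hGnn : ∀ t : ℝ, 0 ≤ t → 0 ≤ G t)
    (hGdiff : ∀ t : ℝ, 0 ≤ t → HasDerivWithinAt G (G' t) (Ici 0) t)
    (hGineq : ∀ t : ℝ, 0 ≤ t → G' t ≤ -c * G t ^ β) {t : ℝ} (ht : 0 ≤ t) (hGt : 0 < G t) :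
    G t ^ (1 - β) ≤ G 0 ^ (1 - β) - (1 - β) * c * t := by
  have hanti : AntitoneOn G (Ici 0) := by
    refine antitoneOn_of_hasDerivWithinAt_nonpos (f' := G') (convex_Ici 0)
      (fun s hs => (hGdiff s hs).continuousWithinAt)
      (fun s hs => (hGdiff s (interior_subset hs)).mono interior_subset) (fun s hs => ?_)
    have hs0 : 0 ≤ s := interior_subset hs
    nlinarith [hGineq s hs0, Real.rpow_nonneg (hGnn s hs0) β]
  have hpos : ∀ s ∈ Icc 0 t, 0 < G s := fun s hs => hGt.trans_le (hanti hs.1 ht hs.2)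
  have hderiv : ∀ s ∈ Icc 0 t, HasDerivWithinAt (fun s => G s ^ (1 - β) + (1 - β) * c * s)
      (G' s * (1 - β) * G s ^ (1 - β - 1) + (1 - β) * c * 1) (Icc 0 t) s := fun s hs =>
    (((hGdiff s hs.1).mono Icc_subset_Ici_self).rpow_const (Or.inl (hpos s hs).ne')).add
      ((hasDerivWithinAt_id s _).const_mul _)
  have hmono := antitoneOn_of_hasDerivWithinAt_nonpos (convex_Icc 0 t)
    (fun s hs => (hderiv s hs).continuousWithinAt)
    (fun s hs => (hderiv s (interior_subset hs)).mono interior_subset) (fun s hs => by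
      have hs := interior_subset hs
      have hcancel : G s ^ β * G s ^ (1 - β - 1) = 1 := by
        rw [← Real.rpow_add (hpos s hs)]
        simp
      have hle : G' s * G s ^ (1 - β - 1) ≤ -c := by
        calc G' s * G s ^ (1 - β - 1) ≤ -c * G s ^ β * G s ^ (1 - β - 1) :=
              mul_le_mul_of_nonneg_right (hGineq s hs.1) (Real.rpow_nonneg (hpos s hs).le _)
          _ = -c := by rw [mul_assoc, hcancel, mul_one]
      nlinarith)
  have h := hmono (left_mem_Icc.2 ht) (right_mem_Icc.2 ht) ht
  simp only [mul_zero, add_zero] at h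
  linarith

/-- Extinction via the two-power differential inequality `G′ ≤ b G^γ − a G^β` with
`0 < β < 1`, `β < γ`, small initial data `b G(0)^{γ−β} < a`: with
`c = a − b G(0)^{γ−β}` and `T₁ = G(0)^{1−β}/((1−β)c)`, one has
`G(t)^{1−β} ≤ G(0)^{1−β} − (1−β) c t` on `[0, T₁]` and `G(t) = 0` for `t ≥ T₁`. -/
theorem extinction_two_power_ode
    (β γ a b : ℝ) (hβ0 : 0 < β) (hβ1 : β < 1) (hβγ : β < γ) (ha : 0 < a) (hb : 0 < b)
    (G G' : ℝ → ℝ)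
    (hGnn : ∀ t : ℝ, 0 ≤ t → 0 ≤ G t)
    (hG0 : 0 < G 0)
    (hGdiff : ∀ t : ℝ, 0 ≤ t → HasDerivWithinAt G (G' t) (Set.Ici 0) t)
    (hGineq : ∀ t : ℝ, 0 ≤ t → G' t ≤ b * G t ^ γ - a * G t ^ β)
    (hsmall : b * G 0 ^ (γ - β) < a)
    (c T₁ : ℝ) (hc : c = a - b * G 0 ^ (γ - β))
    (hT₁ : T₁ = G 0 ^ (1 - β) / ((1 - β) * c)) :
    (∀ t ∈ Set.Icc 0 T₁, G t ^ (1 - β) ≤ G 0 ^ (1 - β) - (1 - β) * c * t) ∧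
    (∀ t : ℝ, T₁ ≤ t → G t = 0) := by
  have hcpos : 0 < c := by linarith
  have hdecay : ∀ t : ℝ, 0 ≤ t → G' t ≤ -c * G t ^ β := by
    intro t ht
    refine (hGineq t ht).trans ?_
    rcases (hGnn t ht).eq_or_lt with hGt | hGt
    · simp [← hGt, Real.zero_rpow hβ0.ne', Real.zero_rpow (hβ0.trans hβγ).ne']
    have hpow : G t ^ γ = G t ^ (γ - β) * G t ^ β := by
      rw [← Real.rpow_add hGt, sub_add_cancel]
    have hle : G t ^ (γ - β) ≤ G 0 ^ (γ - β) :=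
      Real.rpow_le_rpow hGt.le (le_initial_of_two_power_deriv_le hG0 hGdiff hGineq hsmall ht)
        (sub_pos.2 hβγ).le
    have hmul := mul_le_mul_of_nonneg_right (mul_le_mul_of_nonneg_left hle hb.le)
      (Real.rpow_nonneg hGt.le β)
    rw [hpow, hc]
    linarith
  have hbound : ∀ t : ℝ, 0 ≤ t → 0 < G t →
      G t ^ (1 - β) ≤ G 0 ^ (1 - β) - (1 - β) * c * t := fun t ht =>
    rpow_one_sub_le_of_deriv_le_neg_rpow hβ1 hcpos.le hGnn hGdiff hdecay ht
  have hrate : 0 < (1 - β) * c := mul_pos (sub_pos.2 hβ1) hcpos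
  refine ⟨fun t ht => ?_, fun t ht => ?_⟩
  · rcases (hGnn t ht.1).eq_or_lt with hGt | hGt
    · have h := (le_div_iff₀ hrate).1 (hT₁ ▸ ht.2)
      rw [← hGt, Real.zero_rpow (sub_pos.2 hβ1).ne']
      linarith
    · exact hbound t ht.1 hGt
  · have ht0 : 0 ≤ t :=
      (hT₁ ▸ div_nonneg (Real.rpow_nonneg hG0.le _) hrate.le : 0 ≤ T₁).trans ht
    by_contra hne
    have hGt : 0 < G t := (hGnn t ht0).lt_of_ne' hne
    have h := (div_le_iff₀ hrate).1 (hT₁ ▸ ht)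
    linarith [hbound t ht0 hGt, Real.rpow_pos_of_pos hGt (1 - β)]
end

section
/- Let β, κ, δ be real numbers with 0 < β < 1, κ > 0, δ > 0, and set K = (1 − β) · κ / δ. Let H : [0, ∞) → [0, ∞) be differentiable with H(0) > 0, H′(t) ≤ −κ · H(t)^β · e^{−δt} for all t ≥ 0, and H(0)^{1−β} < K. Set T = −(1/δ) · ln(1 − H(0)^{1−β}/K). Then H(t)^{1−β} ≤ H(0)^{1−β} − K · (1 − e^{−δt}) for all t ∈ [0, T], and H(t) = 0 for all t ≥ T. -/
/-- A nonnegative function satisfying `H′ ≤ −κ H^β e^{−δt}` is nonincreasing. -/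
theorem antitoneOn_of_deriv_le_neg_rpow_mul_exp {β κ δ : ℝ} (hκ : 0 ≤ κ) {H H' : ℝ → ℝ}
    (hHnn : ∀ t : ℝ, 0 ≤ t → 0 ≤ H t)
    (hHdiff : ∀ t : ℝ, 0 ≤ t → HasDerivWithinAt H (H' t) (Set.Ici 0) t)
    (hHineq : ∀ t : ℝ, 0 ≤ t → H' t ≤ -κ * H t ^ β * Real.exp (-δ * t)) :
    AntitoneOn H (Set.Ici 0) := by
  refine antitoneOn_of_hasDerivWithinAt_nonpos (f' := H') (convex_Ici 0)
    (fun t ht => (hHdiff t ht).continuousWithinAt)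
    (fun t ht => (hHdiff t (interior_subset ht)).mono interior_subset) fun t ht => ?_
  have ht0 : 0 ≤ t := interior_subset ht
  have hpos : 0 ≤ κ * H t ^ β * Real.exp (-δ * t) :=
    mul_nonneg (mul_nonneg hκ (Real.rpow_nonneg (hHnn t ht0) β)) (Real.exp_pos _).le
  linarith [hHineq t ht0]

/-- As long as it has not vanished, a solution of `H′ ≤ −κ H^β e^{−δt}` satisfies the bound
obtained by integrating the inequality for `H^{1−β}`. -/
theorem rpow_one_sub_le_of_deriv_le_neg_rpow_mul_exp {β κ δ : ℝ} (hβ1 : β < 1) (hκ : 0 ≤ κ)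
    (hδ : δ ≠ 0) {H H' : ℝ → ℝ}
    (hHnn : ∀ t : ℝ, 0 ≤ t → 0 ≤ H t)
    (hHdiff : ∀ t : ℝ, 0 ≤ t → HasDerivWithinAt H (H' t) (Set.Ici 0) t)
    (hHineq : ∀ t : ℝ, 0 ≤ t → H' t ≤ -κ * H t ^ β * Real.exp (-δ * t))
    {t : ℝ} (ht : 0 ≤ t) (hHt : 0 < H t) :
    H t ^ (1 - β) ≤ H 0 ^ (1 - β) - (1 - β) * κ / δ * (1 - Real.exp (-δ * t)) := by
  have hanti := antitoneOn_of_deriv_le_neg_rpow_mul_exp hκ hHnn hHdiff hHineq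
  have hpos : ∀ s ∈ Set.Icc 0 t, 0 < H s := fun s hs =>
    hHt.trans_le (hanti (Set.mem_Ici.2 hs.1) (Set.mem_Ici.2 ht) hs.2)
  have hderiv : ∀ s ∈ Set.Icc 0 t, HasDerivWithinAt
      (fun s => H s ^ (1 - β) - (1 - β) * κ / δ * Real.exp (-δ * s))
      (H' s * (1 - β) * H s ^ (1 - β - 1) - (1 - β) * κ / δ * (Real.exp (-δ * s) * (-δ * 1)))
      (Set.Icc 0 t) s := fun s hs =>
    (((hHdiff s hs.1).mono Set.Icc_subset_Ici_self).rpow_const (Or.inl (hpos s hs).ne')).sub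
      ((((hasDerivAt_id s).const_mul (-δ)).exp.const_mul _).hasDerivWithinAt)
  have hφ := antitoneOn_of_hasDerivWithinAt_nonpos (convex_Icc 0 t)
    (fun s hs => (hderiv s hs).continuousWithinAt)
    (fun s hs => (hderiv s (interior_subset hs)).mono interior_subset) fun s hs => by
      have hs' : s ∈ Set.Icc 0 t := interior_subset hs
      have hcancel : H s ^ β * H s ^ (1 - β - 1) = 1 := by
        rw [← Real.rpow_add (hpos s hs')]
        simp
      have hmul := mul_le_mul_of_nonneg_right (hHineq s hs'.1)
        (mul_nonneg (sub_pos.2 hβ1).le (Real.rpow_nonneg (hpos s hs').le (1 - β - 1)))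
      have hleft : -κ * H s ^ β * Real.exp (-δ * s) * ((1 - β) * H s ^ (1 - β - 1)) =
          -κ * (1 - β) * Real.exp (-δ * s) := by
        linear_combination (-κ * (1 - β) * Real.exp (-δ * s)) * hcancel
      have hright : (1 - β) * κ / δ * (Real.exp (-δ * s) * (-δ * 1)) =
          -κ * (1 - β) * Real.exp (-δ * s) := by
        field_simp
      rw [hright]
      linarith
  have hle := hφ (Set.left_mem_Icc.2 ht) (Set.right_mem_Icc.2 ht) ht
  simp only [mul_zero, Real.exp_zero] at hle
  linarith

/-- Extinction via the differential inequality `H′ ≤ −κ H^β e^{−δt}` with `0 < β < 1`: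
with `K = (1−β)κ/δ`, small initial data `H(0)^{1−β} < K`, and
`T = −(1/δ) ln(1 − H(0)^{1−β}/K)`, one has
`H(t)^{1−β} ≤ H(0)^{1−β} − K(1 − e^{−δt})` on `[0, T]` and `H(t) = 0` for `t ≥ T`. -/
theorem extinction_exponential_weight_ode
    (β κ δ : ℝ) (hβ0 : 0 < β) (hβ1 : β < 1) (hκ : 0 < κ) (hδ : 0 < δ)
    (K : ℝ) (hK : K = (1 - β) * κ / δ)
    (H H' : ℝ → ℝ)
    (hHnn : ∀ t : ℝ, 0 ≤ t → 0 ≤ H t)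
    (hH0 : 0 < H 0)
    (hHdiff : ∀ t : ℝ, 0 ≤ t → HasDerivWithinAt H (H' t) (Set.Ici 0) t)
    (hHineq : ∀ t : ℝ, 0 ≤ t → H' t ≤ -κ * H t ^ β * Real.exp (-δ * t))
    (hsmall : H 0 ^ (1 - β) < K)
    (T : ℝ) (hT : T = -(1 / δ) * Real.log (1 - H 0 ^ (1 - β) / K)) :
    (∀ t ∈ Set.Icc 0 T,
      H t ^ (1 - β) ≤ H 0 ^ (1 - β) - K * (1 - Real.exp (-δ * t))) ∧
    (∀ t : ℝ, T ≤ t → H t = 0) := by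
  have hKpos : 0 < K := (Real.rpow_pos_of_pos hH0 _).trans hsmall
  have hratio : H 0 ^ (1 - β) / K < 1 := (div_lt_one hKpos).2 hsmall
  have hratio0 : 0 < H 0 ^ (1 - β) / K := div_pos (Real.rpow_pos_of_pos hH0 _) hKpos
  have hexpT : Real.exp (-δ * T) = 1 - H 0 ^ (1 - β) / K := by
    rw [hT, show -δ * (-(1 / δ) * Real.log (1 - H 0 ^ (1 - β) / K)) =
      Real.log (1 - H 0 ^ (1 - β) / K) by field_simp, Real.exp_log (by linarith)]
  have hTpos : 0 < T := by
    have : -δ * T < 0 := Real.exp_lt_one_iff.1 (by linarith)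
    nlinarith
  have hboundT : H 0 ^ (1 - β) - K * (1 - Real.exp (-δ * T)) = 0 := by
    rw [hexpT]
    field_simp
    ring
  have hexp : ∀ {s t : ℝ}, s ≤ t → K * Real.exp (-δ * t) ≤ K * Real.exp (-δ * s) := fun hst =>
    mul_le_mul_of_nonneg_left (Real.exp_le_exp.2 (by nlinarith)) hKpos.le
  have hbound : ∀ t, 0 ≤ t → 0 < H t →
      H t ^ (1 - β) ≤ H 0 ^ (1 - β) - K * (1 - Real.exp (-δ * t)) := fun t ht hHt =>
    hK ▸ rpow_one_sub_le_of_deriv_le_neg_rpow_mul_exp hβ1 hκ.le hδ.ne' hHnn hHdiff hHineq ht hHt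
  refine ⟨fun t ht => ?_, fun t ht => ?_⟩
  · rcases (hHnn t ht.1).eq_or_lt with h | h
    · rw [← h, Real.zero_rpow (sub_pos.2 hβ1).ne']
      linarith [hexp ht.2]
    · exact hbound t ht.1 h
  · have ht0 : 0 ≤ t := hTpos.le.trans ht
    by_contra hne
    have hHt : 0 < H t := (hHnn t ht0).lt_of_ne' hne
    linarith [hexp ht, hbound t ht0 hHt, Real.rpow_pos_of_pos hHt (1 - β)]
end
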